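/- Let d ≥ 1, s > d and f ∈ H^s(𝕋^d × 𝕋^d) (so f is a continuous function by Sobolev embedding). Define g : 𝕋^d → ℂ by g(x) = f(x, x). Then g ∈ H^{s'}(𝕋^d) for every s' ≤ s − d/2, and there exists a constant C, depending only on d, s, s', such that ‖g‖_{H^{s'}(𝕋^d)} ≤ C ‖f‖_{H^s(𝕋^d × 𝕋^d)}. -/

import Mathlib

open MeasureTheory Complex Filter
open scoped BigOperators

noncomputable section
namespace PaperTorus

/-- The lattice `ℤ^d` of Fourier modes of the torus `𝕋^d = (ℝ/ℤ)^d`. -/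
abbrev Lat (d : ℕ) := Fin d → ℤ

/-- A distribution `f` on the torus `𝕋^d`, encoded by the family of its pairings
`⟨f, e_k⟩ = f(e_k)` with the characters `e_k(x) = exp(2πi k·x)`, `k ∈ ℤ^d`. -/
abbrev Coef (d : ℕ) := Lat d → ℂ

/-- The Japanese bracket `⟨k⟩ = (1 + |k|²)^(1/2)`. -/
def jap {d : ℕ} (k : Lat d) : ℝ := Real.sqrt (1 + ∑ i, ((k i : ℝ)) ^ 2)

/-- Membership `f ∈ Hˢ(𝕋^d)`: the series `Σ_k ⟨k⟩^(2s) |⟨f,e_k⟩|²` converges. -/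
def MemSob {d : ℕ} (s : ℝ) (f : Coef d) : Prop :=
  Summable fun k : Lat d => jap k ^ (2 * s) * ‖f k‖ ^ 2

/-- The Sobolev norm `‖f‖_{Hˢ(𝕋^d)} = (Σ_k ⟨k⟩^(2s) |⟨f,e_k⟩|²)^(1/2)`. -/
def sobNorm {d : ℕ} (s : ℝ) (f : Coef d) : ℝ :=
  Real.sqrt (∑' k : Lat d, jap k ^ (2 * s) * ‖f k‖ ^ 2)

/-- The inner product `⟨f,g⟩_{Hˢ(𝕋^d)} = Σ_k ⟨k⟩^(2s) ⟨f,e_k⟩ conj(⟨g,e_k⟩)`. -/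
def sobInner {d : ℕ} (s : ℝ) (f g : Coef d) : ℂ :=
  ∑' k : Lat d, ((jap k ^ (2 * s) : ℝ) : ℂ) * f k * (starRingEnd ℂ) (g k)

/-- A distribution on `𝕋^d × 𝕋^d`, encoded by its pairings with the characters
`e_{(k₁,k₂)}(x,y) = e_{k₁}(x) e_{k₂}(y)`. -/
abbrev Coef2 (d : ℕ) := (Lat d × Lat d) → ℂ

/-- The Japanese bracket on `ℤ^d × ℤ^d`. -/
def jap2 {d : ℕ} (k : Lat d × Lat d) : ℝ :=
  Real.sqrt (1 + ∑ i, ((k.1 i : ℝ)) ^ 2 + ∑ i, ((k.2 i : ℝ)) ^ 2)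

/-- Membership `F ∈ Hˢ(𝕋^d × 𝕋^d)`. -/
def MemSob2 {d : ℕ} (s : ℝ) (F : Coef2 d) : Prop :=
  Summable fun k : Lat d × Lat d => jap2 k ^ (2 * s) * ‖F k‖ ^ 2

/-- The Sobolev norm `‖F‖_{Hˢ(𝕋^d × 𝕋^d)}`. -/
def sobNorm2 {d : ℕ} (s : ℝ) (F : Coef2 d) : ℝ :=
  Real.sqrt (∑' k : Lat d × Lat d, jap2 k ^ (2 * s) * ‖F k‖ ^ 2)

/-- Pairings of the restriction to the diagonal `g(x) = f(x,x)` of a continuous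
function `f` on `𝕋^d × 𝕋^d`: `⟨g, e_n⟩ = Σ_{l₁+l₂=n} ⟨f, e_{(l₁,l₂)}⟩`. -/
def diagCoef {d : ℕ} (f : Coef2 d) : Coef d :=
  fun n => ∑' l : Lat d, f (l, n - l)

/-- Telescoping primitive for the one-dimensional sum. -/
def tel (J y : ℝ) : ℝ := y / (J * (J + |y|))

theorem tel_le {J : ℝ} (hJ : 1 ≤ J) (y : ℝ) : tel J y ≤ 1 / J := by
  have h := abs_nonneg y
  have h2 := le_abs_self y
  unfold tel
  rw [div_le_div_iff₀ (by positivity) (by positivity)]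
  nlinarith

theorem neg_le_tel {J : ℝ} (hJ : 1 ≤ J) (y : ℝ) : -(1 / J) ≤ tel J y := by
  have h := tel_le hJ (-y)
  have : tel J (-y) = - tel J y := by
    unfold tel; rw [abs_neg, neg_div]
  linarith

theorem tel_diff {J : ℝ} (hJ : 1 ≤ J) (y : ℤ) :
    1 / (J ^ 2 + (y : ℝ) ^ 2) ≤ 3 * (tel J ((y : ℝ) + 2) - tel J y) := by
  have hJ0 : 0 < J := by linarith
  have key : ∀ t : ℝ, 0 ≤ t →
      1 / (J ^ 2 + t ^ 2) ≤ 3 * (tel J (t + 2) - tel J t) ∧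
      1 / (J ^ 2 + (t + 2) ^ 2) ≤ 3 * (tel J (t + 2) - tel J t) := by
    intro t ht
    have e : 3 * (tel J (t + 2) - tel J t) = 6 / ((J + t) * (J + t + 2)) := by
      unfold tel
      rw [abs_of_nonneg ht, abs_of_nonneg (by linarith : (0 : ℝ) ≤ t + 2)]
      have h1 : J + t ≠ 0 := by positivity
      have h2 : J + t + 2 ≠ 0 := by positivity
      have h3 : J + (t + 2) ≠ 0 := by positivity
      field_simp
      ring
    have h1 : 1 / (J ^ 2 + t ^ 2) ≤ 3 * (tel J (t + 2) - tel J t) := by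
      rw [e, div_le_div_iff₀ (by positivity) (by positivity)]
      nlinarith [sq_nonneg (J - t), mul_nonneg ht hJ0.le]
    refine ⟨h1, le_trans ?_ h1⟩
    apply one_div_le_one_div_of_le (by positivity)
    nlinarith
  have odd : ∀ t : ℝ, tel J (-t) = - tel J t := by
    intro t; unfold tel; rw [abs_neg, neg_div]
  rcases lt_trichotomy y (-1) with h | h | h
  · have h' : (y : ℝ) ≤ -2 := by exact_mod_cast (by omega : y ≤ -2)
    have := (key (-y - 2) (by linarith)).2
    rw [show -(y : ℝ) - 2 + 2 = -y by ring, show -(y : ℝ) - 2 = -(y + 2) by ring, odd, odd] at this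
    rw [neg_sq] at this
    linarith
  · subst h
    have e : 3 * (tel J (((-1 : ℤ) : ℝ) + 2) - tel J ((-1 : ℤ) : ℝ)) = 6 / (J * (J + 1)) := by
      unfold tel
      norm_num
      field_simp
      norm_num
    rw [e, div_le_div_iff₀ (by positivity) (by positivity)]
    push_cast
    nlinarith
  · have h' : (0 : ℝ) ≤ y := by exact_mod_cast (by omega : 0 ≤ y)
    exact (key y h').1

theorem one_dim {J : ℝ} (hJ : 1 ≤ J) (m : ℤ) (T : Finset ℤ) :
    ∑ l ∈ T, 1 / (J ^ 2 + (2 * (l : ℝ) - m) ^ 2) ≤ 6 / J := by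
  have hJ0 : 0 < J := by linarith
  set M : ℕ := T.sup Int.natAbs with hM
  let φ : ℕ → ℤ := fun k => -(M : ℤ) + k
  have hsub : T ⊆ (Finset.range (2 * M + 1)).image φ := by
    intro l hl
    have h : l.natAbs ≤ M := Finset.le_sup (f := Int.natAbs) hl
    rw [Finset.mem_image]
    exact ⟨(l + M).toNat, by rw [Finset.mem_range]; omega, by simp only [φ]; omega⟩
  have hinj : Set.InjOn φ (Finset.range (2 * M + 1) : Set ℕ) := by
    intro a _ b _ h
    simp only [φ] at h
    omega
  calc ∑ l ∈ T, 1 / (J ^ 2 + (2 * (l : ℝ) - m) ^ 2)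
      ≤ ∑ l ∈ (Finset.range (2 * M + 1)).image φ, 1 / (J ^ 2 + (2 * (l : ℝ) - m) ^ 2) :=
        Finset.sum_le_sum_of_subset_of_nonneg hsub (fun _ _ _ => by positivity)
    _ = ∑ k ∈ Finset.range (2 * M + 1), 1 / (J ^ 2 + (2 * ((φ k : ℤ) : ℝ) - m) ^ 2) :=
        Finset.sum_image hinj
    _ ≤ ∑ k ∈ Finset.range (2 * M + 1),
          ((fun k : ℕ => 3 * tel J (2 * (-(M : ℝ) + k) - m)) (k + 1)
            - (fun k : ℕ => 3 * tel J (2 * (-(M : ℝ) + k) - m)) k) := by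
        apply Finset.sum_le_sum
        intro k _
        have := tel_diff hJ (2 * φ k - m)
        simp only [φ] at this ⊢
        push_cast at this ⊢
        rw [show 2 * (-(M : ℝ) + (k + 1)) - m = 2 * (-(M : ℝ) + k) - m + 2 by ring]
        linarith
    _ ≤ 6 / J := by
        rw [Finset.sum_range_sub (fun k : ℕ => 3 * tel J (2 * (-(M : ℝ) + k) - m))]
        have h1 := tel_le hJ (2 * (-(M : ℝ) + (2 * M + 1 : ℕ)) - m)
        have h2 := neg_le_tel hJ (2 * (-(M : ℝ) + (0 : ℕ)) - m)
        have : 6 / J = 6 * (1 / J) := by ring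
        linarith

theorem one_le_jap {d : ℕ} (n : Lat d) : 1 ≤ jap n := by
  unfold jap
  rw [Real.one_le_sqrt]
  have : 0 ≤ ∑ i, (n i : ℝ) ^ 2 := Finset.sum_nonneg (fun _ _ => sq_nonneg _)
  linarith

theorem jap2_pos {d : ℕ} (k : Lat d × Lat d) : 0 < jap2 k := by
  unfold jap2
  have h1 : 0 ≤ ∑ i, (k.1 i : ℝ) ^ 2 := Finset.sum_nonneg (fun _ _ => sq_nonneg _)
  have h2 : 0 ≤ ∑ i, (k.2 i : ℝ) ^ 2 := Finset.sum_nonneg (fun _ _ => sq_nonneg _)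
  positivity

theorem jap2_sq {d : ℕ} (n l : Lat d) (i : Fin d) :
    (jap n ^ 2 + (2 * (l i : ℝ) - n i) ^ 2) / 2 ≤ jap2 (l, n - l) ^ 2 := by
  unfold jap2 jap
  have h0 : 0 ≤ ∑ i, (n i : ℝ) ^ 2 := Finset.sum_nonneg (fun _ _ => sq_nonneg _)
  have h1 : 0 ≤ ∑ i, (l i : ℝ) ^ 2 := Finset.sum_nonneg (fun _ _ => sq_nonneg _)
  have h2 : 0 ≤ ∑ i, ((n - l) i : ℝ) ^ 2 := Finset.sum_nonneg (fun _ _ => sq_nonneg _)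
  rw [Real.sq_sqrt (by positivity), Real.sq_sqrt (by positivity)]
  have h3 : (2 * (l i : ℝ) - n i) ^ 2 ≤ ∑ i, (2 * (l i : ℝ) - n i) ^ 2 :=
    Finset.single_le_sum (f := fun i => (2 * (l i : ℝ) - n i) ^ 2)
      (fun _ _ => sq_nonneg _) (Finset.mem_univ i)
  have h4 : ∑ i, (2 * (l i : ℝ) - n i) ^ 2 + ∑ i, (n i : ℝ) ^ 2
      = 2 * (∑ i, (l i : ℝ) ^ 2 + ∑ i, ((n - l) i : ℝ) ^ 2) := by
    rw [← Finset.sum_add_distrib, ← Finset.sum_add_distrib, Finset.mul_sum]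
    apply Finset.sum_congr rfl
    intro i _
    simp only [Pi.sub_apply]
    push_cast
    ring
  simp only at h4 ⊢
  linarith

theorem weight_le {d : ℕ} (hd : 1 ≤ d) {s : ℝ} (hs : (d : ℝ) < s) (n l : Lat d) :
    jap2 (l, n - l) ^ (-(2 * s)) ≤
      2 ^ s * jap n ^ (2 * (d : ℝ) - 2 * s) *
        ∏ i, 1 / (jap n ^ 2 + (2 * (l i : ℝ) - n i) ^ 2) := by
  have hJ := one_le_jap n
  have hJ0 : 0 < jap n := by linarith
  have hP := jap2_pos (l, n - l)
  have hd0 : (0 : ℝ) < d := by exact_mod_cast hd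
  set J := jap n
  set P := jap2 (l, n - l)
  have hσ : 1 < s / d := by rwa [lt_div_iff₀ hd0, one_mul]
  -- one factor
  have hf : ∀ i, P ^ (-(2 * s) / d) ≤
      2 ^ (s / d) * J ^ (2 - 2 * s / d) * (1 / (J ^ 2 + (2 * (l i : ℝ) - n i) ^ 2)) := by
    intro i
    have hq := jap2_sq n l i
    change (J ^ 2 + _) / 2 ≤ P ^ 2 at hq
    set Q := J ^ 2 + (2 * (l i : ℝ) - n i) ^ 2 with hQ
    have hQJ : J ^ 2 ≤ Q := by rw [hQ]; nlinarith [sq_nonneg (2 * (l i : ℝ) - n i)]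
    have hQ0 : 0 < Q := lt_of_lt_of_le (by positivity) hQJ
    have e1 : P ^ (-(2 * s) / d) = (P ^ 2) ^ (-(s / d)) := by
      rw [← Real.rpow_natCast, ← Real.rpow_mul hP.le]
      congr 1; push_cast; ring
    have e2 : (P ^ 2) ^ (-(s / d)) ≤ (Q / 2) ^ (-(s / d)) :=
      Real.rpow_le_rpow_of_nonpos (by positivity) hq (by linarith)
    have e3 : (Q / 2) ^ (-(s / d)) = 2 ^ (s / d) * (Q ^ (1 - s / d) * (1 / Q)) := by
      rw [Real.div_rpow hQ0.le (by norm_num), Real.rpow_neg (by norm_num : (0 : ℝ) ≤ 2),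
        show -(s / d) = (1 - s / d) - 1 by ring, Real.rpow_sub_one hQ0.ne']
      field_simp
    have e4 : Q ^ (1 - s / d) ≤ J ^ (2 - 2 * s / d) := by
      calc Q ^ (1 - s / d) ≤ (J ^ 2) ^ (1 - s / d) :=
            Real.rpow_le_rpow_of_nonpos (by positivity) hQJ (by linarith)
        _ = J ^ (2 - 2 * s / d) := by
            rw [← Real.rpow_natCast, ← Real.rpow_mul hJ0.le]
            congr 1; push_cast; ring
    rw [e1]
    refine e2.trans ?_
    rw [e3, mul_assoc]
    gcongr
  have hprod := Finset.prod_le_prod (s := Finset.univ)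
    (fun i _ => (Real.rpow_pos_of_pos hP (-(2 * s) / d)).le) (fun i _ => hf i)
  rw [Finset.prod_const, Finset.prod_mul_distrib, Finset.prod_const, Finset.card_univ,
    Fintype.card_fin, mul_pow, ← Real.rpow_natCast, ← Real.rpow_natCast, ← Real.rpow_natCast,
    ← Real.rpow_mul hP.le, ← Real.rpow_mul (by norm_num), ← Real.rpow_mul hJ0.le] at hprod
  rw [show -(2 * s) / d * (d : ℝ) = -(2 * s) by field_simp,
    show s / d * (d : ℝ) = s by field_simp,
    show (2 - 2 * s / d) * (d : ℝ) = 2 * (d : ℝ) - 2 * s by field_simp] at hprod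
  exact hprod

theorem weight_sum {d : ℕ} (hd : 1 ≤ d) {s : ℝ} (hs : (d : ℝ) < s) (n : Lat d)
    (T : Finset (Lat d)) :
    ∑ l ∈ T, jap2 (l, n - l) ^ (-(2 * s)) ≤ 2 ^ s * 6 ^ d * jap n ^ ((d : ℝ) - 2 * s) := by
  have hJ := one_le_jap n
  have hJ0 : 0 < jap n := by linarith
  let t : Fin d → Finset ℤ := fun i => T.image (fun l => l i)
  have hsub : T ⊆ Fintype.piFinset t := by
    intro l hl
    rw [Fintype.mem_piFinset]
    intro i
    exact Finset.mem_image_of_mem _ hl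
  have hnn : ∀ l : Lat d, 0 ≤ ∏ i, 1 / (jap n ^ 2 + (2 * (l i : ℝ) - n i) ^ 2) :=
    fun l => Finset.prod_nonneg (fun i _ => by positivity)
  calc ∑ l ∈ T, jap2 (l, n - l) ^ (-(2 * s))
      ≤ ∑ l ∈ T, 2 ^ s * jap n ^ (2 * (d : ℝ) - 2 * s) *
        ∏ i, 1 / (jap n ^ 2 + (2 * (l i : ℝ) - n i) ^ 2) :=
        Finset.sum_le_sum (fun l _ => weight_le hd hs n l)
    _ = 2 ^ s * jap n ^ (2 * (d : ℝ) - 2 * s) *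
        ∑ l ∈ T, ∏ i, 1 / (jap n ^ 2 + (2 * (l i : ℝ) - n i) ^ 2) := by
        rw [Finset.mul_sum]
    _ ≤ 2 ^ s * jap n ^ (2 * (d : ℝ) - 2 * s) * (6 / jap n) ^ d := by
        gcongr
        calc ∑ l ∈ T, ∏ i, 1 / (jap n ^ 2 + (2 * (l i : ℝ) - n i) ^ 2)
            ≤ ∑ l ∈ Fintype.piFinset t, ∏ i, 1 / (jap n ^ 2 + (2 * (l i : ℝ) - n i) ^ 2) :=
              Finset.sum_le_sum_of_subset_of_nonneg hsub (fun l _ _ => hnn l)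
          _ = ∏ i, ∑ j ∈ t i, 1 / (jap n ^ 2 + (2 * (j : ℝ) - n i) ^ 2) :=
              (Finset.prod_univ_sum t
                (fun i j => 1 / (jap n ^ 2 + (2 * (j : ℝ) - n i) ^ 2))).symm
          _ ≤ ∏ _i : Fin d, 6 / jap n := by
              apply Finset.prod_le_prod
              · intro i _
                exact Finset.sum_nonneg (fun _ _ => by positivity)
              · intro i _
                exact one_dim hJ (n i) (t i)
          _ = (6 / jap n) ^ d := by simp [div_pow]
    _ = 2 ^ s * 6 ^ d * jap n ^ ((d : ℝ) - 2 * s) := by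
        rw [show 2 * (d : ℝ) - 2 * s = ((d : ℝ) - 2 * s) + d by ring, Real.rpow_add hJ0,
          Real.rpow_natCast, div_pow]
        field_simp

theorem fiber_bound {d : ℕ} (hd : 1 ≤ d) {s : ℝ} (hs : (d : ℝ) < s) (f : Coef2 d) (n : Lat d)
    (ha : Summable fun l : Lat d => jap2 (l, n - l) ^ (2 * s) * ‖f (l, n - l)‖ ^ 2) :
    (Summable fun l : Lat d => f (l, n - l)) ∧
    ‖diagCoef f n‖ ^ 2 ≤ 2 ^ s * 6 ^ d * jap n ^ ((d : ℝ) - 2 * s) *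
      ∑' l : Lat d, jap2 (l, n - l) ^ (2 * s) * ‖f (l, n - l)‖ ^ 2 := by
  have hJ := one_le_jap n
  have hJ0 : 0 < jap n := by linarith
  have hann : ∀ l : Lat d, 0 ≤ jap2 (l, n - l) ^ (2 * s) * ‖f (l, n - l)‖ ^ 2 := fun l =>
    mul_nonneg (Real.rpow_nonneg (jap2_pos _).le _) (sq_nonneg _)
  set A := ∑' l : Lat d, jap2 (l, n - l) ^ (2 * s) * ‖f (l, n - l)‖ ^ 2 with hA
  have hA0 : 0 ≤ A := tsum_nonneg hann
  set W := 2 ^ s * 6 ^ d * jap n ^ ((d : ℝ) - 2 * s) with hW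
  have hW0 : 0 ≤ W := by positivity
  have hT : ∀ T : Finset (Lat d), ∑ l ∈ T, ‖f (l, n - l)‖ ≤ Real.sqrt (W * A) := by
    intro T
    apply Real.le_sqrt_of_sq_le
    calc (∑ l ∈ T, ‖f (l, n - l)‖) ^ 2
        ≤ (∑ l ∈ T, jap2 (l, n - l) ^ (-(2 * s))) *
          ∑ l ∈ T, jap2 (l, n - l) ^ (2 * s) * ‖f (l, n - l)‖ ^ 2 := by
          apply Finset.sum_sq_le_sum_mul_sum_of_sq_eq_mul
          · intro l _; exact Real.rpow_nonneg (jap2_pos _).le _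
          · intro l _; exact hann l
          · intro l _
            rw [← mul_assoc, ← Real.rpow_add (jap2_pos _)]
            simp
      _ ≤ W * A := by
          apply mul_le_mul (weight_sum hd hs n T) (ha.sum_le_tsum T (fun l _ => hann l))
            (Finset.sum_nonneg (fun l _ => hann l)) hW0
  have hsn : Summable fun l : Lat d => ‖f (l, n - l)‖ :=
    summable_of_sum_le (fun _ => norm_nonneg _) hT
  refine ⟨hsn.of_norm, ?_⟩
  have h1 : ‖diagCoef f n‖ ≤ Real.sqrt (W * A) :=
    (norm_tsum_le_tsum_norm hsn).trans (Real.tsum_le_of_sum_le (fun _ => norm_nonneg _) hT)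
  calc ‖diagCoef f n‖ ^ 2 ≤ Real.sqrt (W * A) ^ 2 := by gcongr
    _ = W * A := Real.sq_sqrt (by positivity)

/-- Reindexing `(n, l) ↦ (l, n - l)`. -/
def shear (d : ℕ) : (Lat d × Lat d) ≃ (Lat d × Lat d) where
  toFun p := (p.2, p.1 - p.2)
  invFun q := (q.1 + q.2, q.1)
  left_inv p := by ext <;> simp
  right_inv q := by ext <;> simp

/-- let `d ≥ 1`, `s > d` and `f ∈ H^s(𝕋^d × 𝕋^d)` (a continuous
function by Sobolev embedding).  Then `g(x) = f(x,x)` belongs to `H^{s'}(𝕋^d)` for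
every `s' ≤ s − d/2`, with `‖g‖_{H^{s'}(𝕋^d)} ≤ C ‖f‖_{H^s(𝕋^d × 𝕋^d)}`,
`C = C(d, s, s')`. -/
theorem statement8
    (d : ℕ) (hd : 1 ≤ d) (s s' : ℝ) (hs : (d : ℝ) < s) (hs' : s' ≤ s - (d : ℝ) / 2) :
    ∃ C : ℝ, 0 < C ∧
      ∀ f : Coef2 d, MemSob2 s f →
        (∀ n : Lat d, Summable fun l : Lat d => f (l, n - l)) ∧
        MemSob s' (diagCoef f) ∧
        sobNorm s' (diagCoef f) ≤ C * sobNorm2 s f := by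
  refine ⟨Real.sqrt (2 ^ s * 6 ^ d), Real.sqrt_pos.mpr (by positivity), ?_⟩
  intro f hf
  have hf' : Summable fun k : Lat d × Lat d => jap2 k ^ (2 * s) * ‖f k‖ ^ 2 := hf
  have hsh : Summable fun p : Lat d × Lat d =>
      jap2 (p.2, p.1 - p.2) ^ (2 * s) * ‖f (p.2, p.1 - p.2)‖ ^ 2 :=
    (shear d).summable_iff.mpr hf'
  have hfib : ∀ n : Lat d, Summable fun l : Lat d =>
      jap2 (l, n - l) ^ (2 * s) * ‖f (l, n - l)‖ ^ 2 := fun n => hsh.prod_factor n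
  have hA : Summable fun n : Lat d => ∑' l : Lat d,
      jap2 (l, n - l) ^ (2 * s) * ‖f (l, n - l)‖ ^ 2 := hsh.prod
  have htot : ∑' n : Lat d, ∑' l : Lat d, jap2 (l, n - l) ^ (2 * s) * ‖f (l, n - l)‖ ^ 2
      = ∑' k : Lat d × Lat d, jap2 k ^ (2 * s) * ‖f k‖ ^ 2 := by
    rw [← hsh.tsum_prod]
    exact (shear d).tsum_eq (fun k => jap2 k ^ (2 * s) * ‖f k‖ ^ 2)
  have hpt : ∀ n : Lat d, jap n ^ (2 * s') * ‖diagCoef f n‖ ^ 2 ≤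
      2 ^ s * 6 ^ d * ∑' l : Lat d, jap2 (l, n - l) ^ (2 * s) * ‖f (l, n - l)‖ ^ 2 := by
    intro n
    have hJ := one_le_jap n
    have hJ0 : 0 < jap n := by linarith
    have hb := (fiber_bound hd hs f n (hfib n)).2
    have hA0 : 0 ≤ ∑' l : Lat d, jap2 (l, n - l) ^ (2 * s) * ‖f (l, n - l)‖ ^ 2 :=
      tsum_nonneg (fun l => mul_nonneg (Real.rpow_nonneg (jap2_pos _).le _) (sq_nonneg _))
    set A := ∑' l : Lat d, jap2 (l, n - l) ^ (2 * s) * ‖f (l, n - l)‖ ^ 2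
    have hle : jap n ^ (2 * s') * jap n ^ ((d : ℝ) - 2 * s) ≤ 1 := by
      rw [← Real.rpow_add hJ0]
      exact Real.rpow_le_one_of_one_le_of_nonpos hJ (by linarith)
    calc jap n ^ (2 * s') * ‖diagCoef f n‖ ^ 2
        ≤ jap n ^ (2 * s') * (2 ^ s * 6 ^ d * jap n ^ ((d : ℝ) - 2 * s) * A) := by gcongr
      _ = (jap n ^ (2 * s') * jap n ^ ((d : ℝ) - 2 * s)) * (2 ^ s * 6 ^ d * A) := by ring
      _ ≤ 1 * (2 ^ s * 6 ^ d * A) := by gcongr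
      _ = 2 ^ s * 6 ^ d * A := one_mul _
  have hmem : Summable fun n : Lat d => jap n ^ (2 * s') * ‖diagCoef f n‖ ^ 2 := by
    refine Summable.of_nonneg_of_le (fun n => ?_) hpt (hA.mul_left _)
    exact mul_nonneg (Real.rpow_nonneg (by linarith [one_le_jap n]) _) (sq_nonneg _)
  refine ⟨fun n => (fiber_bound hd hs f n (hfib n)).1, hmem, ?_⟩
  unfold sobNorm sobNorm2
  rw [← Real.sqrt_mul (by positivity)]
  apply Real.sqrt_le_sqrt
  rw [← htot, ← tsum_mul_left]
  exact hmem.tsum_le_tsum hpt (hA.mul_left _)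

end PaperTorus
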